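/- The functions φ₂ and φ₄ of the quadrilateral Lin–Tobiska–Zhou (QLTZ) element are dual to the edge-average degrees of freedom on e₂ and e₄ respectively: ⨍_Q φ₂ = 0, ⨍_{e₂}φ₂ = 1, ⨍_{e₁}φ₂ = ⨍_{e₃}φ₂ = ⨍_{e₄}φ₂ = 0; and ⨍_Q φ₄ = 0, ⨍_{e₄}φ₄ = 1, ⨍_{e₁}φ₄ = ⨍_{e₂}φ₄ = ⨍_{e₃}φ₄ = 0. That is, dᵢ(φ₂) = δ_{i2} and dᵢ(φ₄) = δ_{i4} for i = 0,…,4. -/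

import Mathlib

open MeasureTheory

noncomputable section

/-- Vertex a₁ of the reference convex quadrilateral (points written as (η, ξ)). -/
def a1 (α β : ℝ) : ℝ × ℝ := (-1 - α, 1 - β)

/-- Vertex a₂. -/
def a2 (α β : ℝ) : ℝ × ℝ := (-1 + α, -1 + β)

/-- Vertex a₃. -/
def a3 (α β : ℝ) : ℝ × ℝ := (1 - α, -1 - β)

/-- Vertex a₄. -/
def a4 (α β : ℝ) : ℝ × ℝ := (1 + α, 1 + β)

/-- The reference convex quadrilateral Q = conv{a₁, a₂, a₃, a₄}. -/
def Quad (α β : ℝ) : Set (ℝ × ℝ) :=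
  convexHull ℝ {a1 α β, a2 α β, a3 α β, a4 α β}

/-- Average of `u` over the segment from `P` to `R`:
    ⨍ u = ∫_{t ∈ [0,1]} u((1−t)P + tR) dt. -/
def edgeAvg (P R : ℝ × ℝ) (u : ℝ × ℝ → ℝ) : ℝ :=
  ∫ t in (0:ℝ)..1, u ((1 - t) • P + t • R)

/-- Average of `u` over the quadrilateral Q: (∫_Q u dλ)/λ(Q). -/
def quadAvg (α β : ℝ) (u : ℝ × ℝ → ℝ) : ℝ :=
  (∫ p in Quad α β, u p) / (volume (Quad α β)).toReal

/-- The basis function φ₀ of the QLTZ element: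
φ₀ = −3(3ξ² + 3η² − 2αξ − 2βη − (4 + α² + β²))/(2(α² + β² + 3)),
with ξ(p) = p.2 and η(p) = p.1. -/
def phi0 (α β : ℝ) (p : ℝ × ℝ) : ℝ :=
  -3 * (3 * p.2 ^ 2 + 3 * p.1 ^ 2 - 2 * α * p.2 - 2 * β * p.1 - (4 + α ^ 2 + β ^ 2)) /
    (2 * (α ^ 2 + β ^ 2 + 3))

/-- φ₁ = −(3/4)ξ² + ((β−1)/2)η + (3+β²)/4 − ((β²−β+3)/6)φ₀. -/
def phi1 (α β : ℝ) (p : ℝ × ℝ) : ℝ :=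
  -(3 / 4) * p.2 ^ 2 + (β - 1) / 2 * p.1 + (3 + β ^ 2) / 4 -
    (β ^ 2 - β + 3) / 6 * phi0 α β p

/-- φ₂ = −(3/4)η² + ((α−1)/2)ξ + (3+α²)/4 − ((α²−α+3)/6)φ₀. -/
def phi2 (α β : ℝ) (p : ℝ × ℝ) : ℝ :=
  -(3 / 4) * p.1 ^ 2 + (α - 1) / 2 * p.2 + (3 + α ^ 2) / 4 -
    (α ^ 2 - α + 3) / 6 * phi0 α β p

/-- φ₃ = −(3/4)ξ² + ((β+1)/2)η + (3+β²)/4 − ((β²+β+3)/6)φ₀. -/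
def phi3 (α β : ℝ) (p : ℝ × ℝ) : ℝ :=
  -(3 / 4) * p.2 ^ 2 + (β + 1) / 2 * p.1 + (3 + β ^ 2) / 4 -
    (β ^ 2 + β + 3) / 6 * phi0 α β p

/-- φ₄ = −(3/4)η² + ((α+1)/2)ξ + (3+α²)/4 − ((α²+α+3)/6)φ₀. -/
def phi4 (α β : ℝ) (p : ℝ × ℝ) : ℝ :=
  -(3 / 4) * p.1 ^ 2 + (α + 1) / 2 * p.2 + (3 + α ^ 2) / 4 -
    (α ^ 2 + α + 3) / 6 * phi0 α β p

/-- The bilinear map from the square `[-1, 1]²` onto the reference quadrilateral. -/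
def bilinearMap (α β : ℝ) (q : ℝ × ℝ) : ℝ × ℝ :=
  (q.1 + α * (q.1 * q.2), q.2 + β * (q.1 * q.2))

/-- The derivative of `bilinearMap`. -/
def bilinearMapDeriv (α β : ℝ) (q : ℝ × ℝ) : ℝ × ℝ →L[ℝ] ℝ × ℝ :=
  LinearMap.toContinuousLinearMap
    (Matrix.toLin (Module.Basis.finTwoProd ℝ) (Module.Basis.finTwoProd ℝ)
      !![1 + α * q.2, α * q.1; β * q.2, 1 + β * q.1])

lemma hasFDerivAt_bilinearMap (α β : ℝ) (q : ℝ × ℝ) :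
    HasFDerivAt (bilinearMap α β) (bilinearMapDeriv α β q) q := by
  unfold bilinearMap bilinearMapDeriv
  rw [Matrix.toLin_finTwoProd_toContinuousLinearMap]
  have hx : HasFDerivAt (Prod.fst : ℝ × ℝ → ℝ) (ContinuousLinearMap.fst ℝ ℝ ℝ) q := hasFDerivAt_fst
  have hy : HasFDerivAt (Prod.snd : ℝ × ℝ → ℝ) (ContinuousLinearMap.snd ℝ ℝ ℝ) q := hasFDerivAt_snd
  have hxy := hx.mul hy
  refine ((hx.add (hxy.const_mul α)).prodMk (hy.add (hxy.const_mul β))).congr_fderiv ?_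
  ext <;> simp

lemma det_bilinearMapDeriv (α β : ℝ) (q : ℝ × ℝ) :
    (bilinearMapDeriv α β q).det = 1 + α * q.2 + β * q.1 := by
  rw [bilinearMapDeriv, LinearMap.det_toContinuousLinearMap, LinearMap.det_toLin,
    Matrix.det_fin_two_of]
  ring

lemma jacobian_pos {α β x y : ℝ} (hα : 0 < α) (hβ : 0 < β) (hαβ : α + β < 1)
    (hx : x ∈ Set.Icc (-1 : ℝ) 1) (hy : y ∈ Set.Icc (-1 : ℝ) 1) : 0 < 1 + α * y + β * x := by
  obtain ⟨hx, -⟩ := hx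
  obtain ⟨hy, -⟩ := hy
  nlinarith

lemma injOn_bilinearMap {α β : ℝ} (hα : 0 < α) (hβ : 0 < β) (hαβ : α + β < 1) :
    Set.InjOn (bilinearMap α β) (Set.Icc (-1 : ℝ) 1 ×ˢ Set.Icc (-1 : ℝ) 1) := by
  rintro ⟨x, y⟩ ⟨hx, hy⟩ ⟨x', y'⟩ ⟨hx', hy'⟩ h
  simp only [bilinearMap, Prod.mk.injEq] at h hx hy hx' hy' ⊢
  obtain ⟨h₁, h₂⟩ := h
  have hJ : 0 < 1 + α * y + β * x' := jacobian_pos hα hβ hαβ hx' hy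
  have hxx : (x - x') * (1 + α * y + β * x') = 0 := by
    linear_combination (1 + β * x') * h₁ - α * x' * h₂
  have hyy : (y - y') * (1 + α * y + β * x') = 0 := by
    linear_combination (1 + α * y) * h₂ - β * y * h₁
  constructor
  · linarith [(mul_eq_zero.mp hxx).resolve_right hJ.ne']
  · linarith [(mul_eq_zero.mp hyy).resolve_right hJ.ne']

lemma bilinearMap_mem_Quad (α β : ℝ) {x y : ℝ}
    (hx : x ∈ Set.Icc (-1 : ℝ) 1) (hy : y ∈ Set.Icc (-1 : ℝ) 1) :
    bilinearMap α β (x, y) ∈ Quad α β := by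
  obtain ⟨hx₁, hx₂⟩ := hx
  obtain ⟨hy₁, hy₂⟩ := hy
  have hQ : Convex ℝ (Quad α β) := convex_convexHull ℝ _
  have hV : {a1 α β, a2 α β, a3 α β, a4 α β} ⊆ Quad α β := subset_convexHull ℝ _
  have hl := hQ (hV (by simp) : a2 α β ∈ _) (hV (by simp) : a1 α β ∈ _)
    (by linarith : 0 ≤ (1 - y) / 2) (by linarith : 0 ≤ (1 + y) / 2) (by ring)
  have hr := hQ (hV (by simp) : a3 α β ∈ _) (hV (by simp) : a4 α β ∈ _)
    (by linarith : 0 ≤ (1 - y) / 2) (by linarith : 0 ≤ (1 + y) / 2) (by ring)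
  convert hQ hl hr
    (by linarith : 0 ≤ (1 - x) / 2) (by linarith : 0 ≤ (1 + x) / 2) (by ring) using 1
  ext <;> simp [bilinearMap, a1, a2, a3, a4] <;> ring

lemma Quad_subset_halfPlane {α β a b c : ℝ}
    (h₁ : 0 ≤ a * (-1 - α) + b * (1 - β) + c) (h₂ : 0 ≤ a * (-1 + α) + b * (-1 + β) + c)
    (h₃ : 0 ≤ a * (1 - α) + b * (-1 - β) + c) (h₄ : 0 ≤ a * (1 + α) + b * (1 + β) + c) :
    Quad α β ⊆ {p | 0 ≤ a * p.1 + b * p.2 + c} := by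
  refine convexHull_min ?_ ?_
  · rintro p (rfl | rfl | rfl | rfl) <;> simpa [a1, a2, a3, a4]
  · intro p hp q hq s t hs ht hst
    simp only [Set.mem_ofPred_eq, Prod.fst_add, Prod.snd_add, Prod.smul_fst, Prod.smul_snd,
      smul_eq_mul] at hp hq ⊢
    have := add_nonneg (mul_nonneg hs hp) (mul_nonneg ht hq)
    linear_combination this + c * hst

lemma image_bilinearMap {α β : ℝ} (hα : 0 < α) (hβ : 0 < β) (hαβ : α + β < 1) :
    bilinearMap α β '' (Set.Icc (-1 : ℝ) 1 ×ˢ Set.Icc (-1 : ℝ) 1) = Quad α β := by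
  apply Set.Subset.antisymm
  · rintro _ ⟨⟨x, y⟩, ⟨hx, hy⟩, rfl⟩
    exact bilinearMap_mem_Quad α β hx hy
  rintro ⟨η, ξ⟩ hp
  have left : 0 ≤ (1 - β) * η + α * ξ + (1 - β) :=
    Quad_subset_halfPlane (by nlinarith) (by nlinarith) (by nlinarith) (by nlinarith) hp
  have right : 0 ≤ -(1 + β) * η + α * ξ + (1 + β) :=
    Quad_subset_halfPlane (by nlinarith) (by nlinarith) (by nlinarith) (by nlinarith) hp
  have bottom : 0 ≤ β * η + (1 - α) * ξ + (1 - α) :=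
    Quad_subset_halfPlane (by nlinarith) (by nlinarith) (by nlinarith) (by nlinarith) hp
  have top : 0 ≤ β * η + -(1 + α) * ξ + (1 + α) :=
    Quad_subset_halfPlane (by nlinarith) (by nlinarith) (by nlinarith) (by nlinarith) hp
  obtain ⟨y, hy, hroot⟩ : (0 : ℝ) ∈
      (fun y : ℝ => y * (1 + α * y + β * η) - ξ * (1 + α * y)) '' Set.Icc (-1) 1 := by
    refine intermediate_value_Icc (by norm_num) (by fun_prop) ⟨?_, ?_⟩
    · linarith
    · linarith
  have hpos : 0 < 1 + α * y := by nlinarith [hy.1]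
  obtain ⟨x, rfl⟩ : ∃ x, η = x * (1 + α * y) := ⟨η / (1 + α * y), by field_simp⟩
  obtain rfl : ξ = y * (1 + β * x) := by
    apply mul_right_cancel₀ hpos.ne'
    linear_combination -hroot
  refine ⟨(x, y), ⟨⟨?_, ?_⟩, hy⟩, by simp only [bilinearMap]; ext <;> ring⟩
  · have hc : 0 < 1 - β + α * y := by nlinarith [hy.1]
    have : 0 ≤ (1 + x) * (1 - β + α * y) := by linear_combination left
    linarith [nonneg_of_mul_nonneg_left this hc]
  · have hc : 0 < 1 + β + α * y := by nlinarith [hy.1]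
    have : 0 ≤ (1 - x) * (1 + β + α * y) := by linear_combination right
    linarith [nonneg_of_mul_nonneg_left this hc]

lemma integral_Quad {α β : ℝ} (hα : 0 < α) (hβ : 0 < β) (hαβ : α + β < 1)
    {u : ℝ × ℝ → ℝ} (hu : Continuous u) :
    ∫ p in Quad α β, u p =
      ∫ x in (-1 : ℝ)..1, ∫ y in (-1 : ℝ)..1,
        (1 + α * y + β * x) * u (x + α * (x * y), y + β * (x * y)) := by
  have hS : MeasurableSet (Set.Icc (-1 : ℝ) 1 ×ˢ Set.Icc (-1 : ℝ) 1) :=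
    measurableSet_Icc.prod measurableSet_Icc
  rw [← image_bilinearMap hα hβ hαβ, integral_image_eq_integral_abs_det_fderiv_smul volume hS
    (fun q _ => (hasFDerivAt_bilinearMap α β q).hasFDerivWithinAt) (injOn_bilinearMap hα hβ hαβ)]
  have hJ : Set.EqOn (fun q => |(bilinearMapDeriv α β q).det| • u (bilinearMap α β q))
      (fun q => (1 + α * q.2 + β * q.1) * u (q.1 + α * (q.1 * q.2), q.2 + β * (q.1 * q.2)))
      (Set.Icc (-1 : ℝ) 1 ×ˢ Set.Icc (-1 : ℝ) 1) := by
    intro q hq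
    simp only [det_bilinearMapDeriv, abs_of_pos (jacobian_pos hα hβ hαβ hq.1 hq.2), smul_eq_mul,
      bilinearMap]
  rw [setIntegral_congr_fun hS hJ, Measure.volume_eq_prod, setIntegral_prod]
  · simp only [intervalIntegral.integral_of_le (by norm_num : (-1 : ℝ) ≤ 1),
      integral_Icc_eq_integral_Ioc]
  · exact ContinuousOn.integrableOn_compact (isCompact_Icc.prod isCompact_Icc)
      (Continuous.continuousOn (by fun_prop))

lemma integral_cubic (a b A B C E : ℝ) :
    ∫ t in a..b, (A + B * t + C * t ^ 2 + E * t ^ 3) =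
      (A * b + B * (b ^ 2 / 2) + C * (b ^ 3 / 3) + E * (b ^ 4 / 4)) -
        (A * a + B * (a ^ 2 / 2) + C * (a ^ 3 / 3) + E * (a ^ 4 / 4)) := by
  have h (t : ℝ) : HasDerivAt
      (fun t : ℝ => A * t + B * (t ^ 2 / 2) + C * (t ^ 3 / 3) + E * (t ^ 4 / 4))
      (A + B * t + C * t ^ 2 + E * t ^ 3) t := by
    refine (((((hasDerivAt_id t).const_mul A).add
      (((hasDerivAt_pow 2 t).div_const 2).const_mul B)).add
      (((hasDerivAt_pow 3 t).div_const 3).const_mul C)).add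
      (((hasDerivAt_pow 4 t).div_const 4).const_mul E)).congr_deriv ?_
    push_cast
    ring
  exact intervalIntegral.integral_eq_sub_of_hasDerivAt (fun t _ => h t)
    (Continuous.intervalIntegrable (by fun_prop) _ _)

lemma integral_cubic_symm (A B C E : ℝ) :
    ∫ t in (-1 : ℝ)..1, (A + B * t + C * t ^ 2 + E * t ^ 3) = 2 * A + 2 * C / 3 := by
  rw [integral_cubic]
  ring

lemma integral_cubic_zero_one (A B C E : ℝ) :
    ∫ t in (0 : ℝ)..1, (A + B * t + C * t ^ 2 + E * t ^ 3) = A + B / 2 + C / 3 + E / 4 := by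
  rw [integral_cubic]
  ring

/-- The integral over `Quad` of a quadratic polynomial without mixed term. -/
lemma integral_Quad_quadratic {α β : ℝ} (hα : 0 < α) (hβ : 0 < β) (hαβ : α + β < 1)
    {u : ℝ × ℝ → ℝ} {c₀ c₁ c₂ c₃ c₄ : ℝ}
    (hu : ∀ p, u p = c₀ + c₁ * p.1 + c₂ * p.2 + c₃ * p.1 ^ 2 + c₄ * p.2 ^ 2) :
    ∫ p in Quad α β, u p =
      4 * (c₀ + c₁ * (β / 3) + c₂ * (α / 3) + c₃ * ((1 + α ^ 2) / 3) +
        c₄ * ((1 + β ^ 2) / 3)) := by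
  obtain rfl := funext hu
  rw [integral_Quad hα hβ hαβ (by fun_prop)]
  have inner (x : ℝ) : ∫ y in (-1 : ℝ)..1, (1 + α * y + β * x) *
      (c₀ + c₁ * (x + α * (x * y)) + c₂ * (y + β * (x * y)) + c₃ * (x + α * (x * y)) ^ 2 +
        c₄ * (y + β * (x * y)) ^ 2) =
      (2 * c₀ + 2 / 3 * (c₄ + α * c₂)) +
      (2 * (c₁ + β * c₀) + 2 / 3 * (3 * β * c₄ + α ^ 2 * c₁ + α * β * c₂)) * x +
      (2 * (c₃ + β * c₁) + 2 * (α ^ 2 * c₃ + β ^ 2 * c₄)) * x ^ 2 +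
      (2 * β * c₃ + 2 / 3 * (α ^ 2 * β * c₃ + β ^ 3 * c₄)) * x ^ 3 := by
    convert integral_cubic_symm
      ((1 + β * x) * (c₀ + c₁ * x + c₃ * x ^ 2))
      ((1 + β * x) * (α * c₁ * x + c₂ * (1 + β * x) + 2 * α * c₃ * x ^ 2) +
        α * (c₀ + c₁ * x + c₃ * x ^ 2))
      ((1 + β * x) * (α ^ 2 * c₃ * x ^ 2 + c₄ * (1 + β * x) ^ 2) +
        α * (α * c₁ * x + c₂ * (1 + β * x) + 2 * α * c₃ * x ^ 2))
      (α * (α ^ 2 * c₃ * x ^ 2 + c₄ * (1 + β * x) ^ 2)) using 1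
    · congr 1
      ext y
      ring
    · ring
  simp only [inner, integral_cubic_symm]
  ring

lemma edgeAvg_quadratic {P R : ℝ × ℝ} {u : ℝ × ℝ → ℝ} {c₀ c₁ c₂ c₃ c₄ : ℝ}
    (hu : ∀ p, u p = c₀ + c₁ * p.1 + c₂ * p.2 + c₃ * p.1 ^ 2 + c₄ * p.2 ^ 2) :
    edgeAvg P R u = c₀ + c₁ * ((P.1 + R.1) / 2) + c₂ * ((P.2 + R.2) / 2) +
      c₃ * ((P.1 ^ 2 + P.1 * R.1 + R.1 ^ 2) / 3) +
      c₄ * ((P.2 ^ 2 + P.2 * R.2 + R.2 ^ 2) / 3) := by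
  obtain rfl := funext hu
  obtain ⟨a, b⟩ := P
  obtain ⟨c, d⟩ := R
  simp only [edgeAvg, Prod.fst_add, Prod.snd_add, Prod.smul_fst, Prod.smul_snd, smul_eq_mul]
  convert integral_cubic_zero_one (c₀ + c₁ * a + c₂ * b + c₃ * a ^ 2 + c₄ * b ^ 2)
    (c₁ * (c - a) + c₂ * (d - b) + 2 * c₃ * a * (c - a) + 2 * c₄ * b * (d - b))
    (c₃ * (c - a) ^ 2 + c₄ * (d - b) ^ 2) 0 using 1
  · congr 1
    ext t
    ring
  · ring

lemma denom_pos (α β : ℝ) : 0 < α ^ 2 + β ^ 2 + 3 := by positivity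

lemma phi0_eq (α β : ℝ) (p : ℝ × ℝ) :
    phi0 α β p = 3 * (4 + α ^ 2 + β ^ 2) / (2 * (α ^ 2 + β ^ 2 + 3)) +
      3 * β / (α ^ 2 + β ^ 2 + 3) * p.1 + 3 * α / (α ^ 2 + β ^ 2 + 3) * p.2 +
      -9 / (2 * (α ^ 2 + β ^ 2 + 3)) * p.1 ^ 2 + -9 / (2 * (α ^ 2 + β ^ 2 + 3)) * p.2 ^ 2 := by
  have := (denom_pos α β).ne'
  unfold phi0
  field_simp
  ring

/-- The quadratic polynomial that is `phi2` for `s = -1` and `phi4` for `s = 1`. -/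
def phiHorizontal (α β s : ℝ) (p : ℝ × ℝ) : ℝ :=
  -(3 / 4) * p.1 ^ 2 + (α + s) / 2 * p.2 + (3 + α ^ 2) / 4 -
    (α ^ 2 + s * α + 3) / 6 * phi0 α β p

lemma phi2_eq (α β : ℝ) : phi2 α β = phiHorizontal α β (-1) := by
  ext p
  unfold phi2 phiHorizontal
  ring

lemma phi4_eq (α β : ℝ) : phi4 α β = phiHorizontal α β 1 := by
  ext p
  unfold phi4 phiHorizontal
  ring

lemma phiHorizontal_eq (α β s : ℝ) (p : ℝ × ℝ) :
    phiHorizontal α β s p =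
      ((3 + α ^ 2) / 4 - (α ^ 2 + s * α + 3) / 6 *
        (3 * (4 + α ^ 2 + β ^ 2) / (2 * (α ^ 2 + β ^ 2 + 3)))) +
      -((α ^ 2 + s * α + 3) / 6 * (3 * β / (α ^ 2 + β ^ 2 + 3))) * p.1 +
      ((α + s) / 2 - (α ^ 2 + s * α + 3) / 6 * (3 * α / (α ^ 2 + β ^ 2 + 3))) * p.2 +
      (-(3 / 4) - (α ^ 2 + s * α + 3) / 6 * (-9 / (2 * (α ^ 2 + β ^ 2 + 3)))) * p.1 ^ 2 +
      -((α ^ 2 + s * α + 3) / 6 * (-9 / (2 * (α ^ 2 + β ^ 2 + 3)))) * p.2 ^ 2 := by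
  rw [phiHorizontal, phi0_eq]
  ring

lemma quadAvg_phiHorizontal {α β : ℝ} (hα : 0 < α) (hβ : 0 < β) (hαβ : α + β < 1) (s : ℝ) :
    quadAvg α β (phiHorizontal α β s) = 0 := by
  have := (denom_pos α β).ne'
  rw [quadAvg, integral_Quad_quadratic hα hβ hαβ (phiHorizontal_eq α β s), div_eq_zero_iff]
  left
  field_simp
  ring

lemma edgeAvg_e1_phiHorizontal (α β s : ℝ) :
    edgeAvg (a1 α β) (a2 α β) (phiHorizontal α β s) = 0 := by
  have := (denom_pos α β).ne'
  rw [edgeAvg_quadratic (phiHorizontal_eq α β s)]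
  simp only [a1, a2]
  field_simp
  ring

lemma edgeAvg_e2_phiHorizontal (α β s : ℝ) :
    edgeAvg (a2 α β) (a3 α β) (phiHorizontal α β s) = (1 - s) / 2 := by
  have := (denom_pos α β).ne'
  rw [edgeAvg_quadratic (phiHorizontal_eq α β s)]
  simp only [a2, a3]
  field_simp
  ring

lemma edgeAvg_e3_phiHorizontal (α β s : ℝ) :
    edgeAvg (a3 α β) (a4 α β) (phiHorizontal α β s) = 0 := by
  have := (denom_pos α β).ne'
  rw [edgeAvg_quadratic (phiHorizontal_eq α β s)]
  simp only [a3, a4]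
  field_simp
  ring

lemma edgeAvg_e4_phiHorizontal (α β s : ℝ) :
    edgeAvg (a4 α β) (a1 α β) (phiHorizontal α β s) = (1 + s) / 2 := by
  have := (denom_pos α β).ne'
  rw [edgeAvg_quadratic (phiHorizontal_eq α β s)]
  simp only [a4, a1]
  field_simp
  ring

/-- φ₂ and φ₄ are dual to the edge-average degrees of freedom on e₂ and e₄:
dᵢ(φ₂) = δ_{i2} and dᵢ(φ₄) = δ_{i4} for i = 0, …, 4. -/
theorem phi2_phi4_dual (α β : ℝ) (hα : 0 < α) (hβ : 0 < β) (hαβ : α + β < 1) :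
    quadAvg α β (phi2 α β) = 0 ∧
    edgeAvg (a1 α β) (a2 α β) (phi2 α β) = 0 ∧
    edgeAvg (a2 α β) (a3 α β) (phi2 α β) = 1 ∧
    edgeAvg (a3 α β) (a4 α β) (phi2 α β) = 0 ∧
    edgeAvg (a4 α β) (a1 α β) (phi2 α β) = 0 ∧
    quadAvg α β (phi4 α β) = 0 ∧
    edgeAvg (a1 α β) (a2 α β) (phi4 α β) = 0 ∧
    edgeAvg (a2 α β) (a3 α β) (phi4 α β) = 0 ∧
    edgeAvg (a3 α β) (a4 α β) (phi4 α β) = 0 ∧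
    edgeAvg (a4 α β) (a1 α β) (phi4 α β) = 1 := by
  rw [phi2_eq, phi4_eq]
  simp only [quadAvg_phiHorizontal hα hβ hαβ, edgeAvg_e1_phiHorizontal, edgeAvg_e2_phiHorizontal,
    edgeAvg_e3_phiHorizontal, edgeAvg_e4_phiHorizontal]
  norm_num
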